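/- Let G be a connected graph on n vertices and let k be an integer with 3 ≤ k ≤ n. Then μ_k(G) ≤ ((k+1)/(k−1)) · μ_{k−1}(G). -/

import Mathlib

/-- The Steiner distance of a set `S` of vertices of `G`: the minimum number of edges
of a connected subgraph of `G` containing all vertices of `S`. -/
noncomputable def steinerDist {V : Type*} (G : SimpleGraph V) (S : Set V) : ℕ :=
  sInf {n | ∃ H : G.Subgraph, H.Connected ∧ S ⊆ H.verts ∧ H.edgeSet.ncard = n}
/-- The Steiner `k`-Wiener index of `G`: the sum of the Steiner distances of all
`k`-element subsets of vertices of `G`. -/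
noncomputable def steinerWiener {V : Type*} (G : SimpleGraph V) [Fintype V] (k : ℕ) : ℕ :=
  ∑ S ∈ (Finset.univ : Finset V).powersetCard k, steinerDist G (S : Set V)
/-- The average `k`-Steiner distance of `G`: the average of the Steiner distances of
all `k`-element subsets of vertices of `G`. -/
noncomputable def avgSteinerDist {V : Type*} (G : SimpleGraph V) [Fintype V] (k : ℕ) : ℝ :=
  (steinerWiener G k : ℝ) / ((Fintype.card V).choose k)

open Finset in
theorem Finset.sum_powersetCard_succ_sum_erase {α : Type*} [Fintype α] [DecidableEq α]
    (f : Finset α → ℕ) (r : ℕ) :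
    ∑ S ∈ (univ : Finset α).powersetCard (r + 1), ∑ z ∈ S, f (S.erase z) =
      (Fintype.card α - r) * ∑ T ∈ (univ : Finset α).powersetCard r, f T := by
  have h : ∀ T ∈ (univ : Finset α).powersetCard r,
      (Fintype.card α - r) * f T = ∑ _z ∈ Tᶜ, f T := by
    intro T hT
    rw [sum_const, card_compl, (mem_powersetCard.1 hT).2, smul_eq_mul]
  rw [mul_sum, sum_congr rfl h, sum_sigma', sum_sigma']
  refine sum_bij' (fun p _ => ⟨p.1.erase p.2, p.2⟩) (fun p _ => ⟨insert p.2 p.1, p.2⟩)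
    ?_ ?_ ?_ ?_ ?_
  · rintro ⟨S, z⟩ hp
    simp only [mem_sigma, mem_powersetCard, subset_univ, true_and] at hp
    simp [card_erase_of_mem hp.2, hp.1]
  · rintro ⟨T, z⟩ hp
    simp only [mem_sigma, mem_powersetCard, subset_univ, true_and, mem_compl] at hp
    simp [card_insert_of_notMem hp.2, hp.1]
  · rintro ⟨S, z⟩ hp
    simp only [mem_sigma, mem_powersetCard, subset_univ, true_and] at hp
    simp [insert_erase hp.2]
  · rintro ⟨T, z⟩ hp
    simp only [mem_sigma, mem_powersetCard, subset_univ, true_and, mem_compl] at hp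
    simp [erase_insert hp.2]
  · simp

namespace SimpleGraph

variable {V : Type*} {G : SimpleGraph V}

/-- A discrete intermediate value theorem along a walk. -/
theorem Walk.exists_adj_eq_and_eq_add_one (f : V → ℕ) (hf : ∀ u v, G.Adj u v → f v ≤ f u + 1)
    {a b : V} (p : G.Walk a b) {i : ℕ} (ha : f a ≤ i) (hb : i < f b) :
    ∃ u v, G.Adj u v ∧ f u = i ∧ f v = i + 1 := by
  induction p with
  | nil => omega
  | @cons u v w h p ih =>
    by_cases hv : f v ≤ i
    · exact ih hv hb
    · have := hf u v h
      exact ⟨u, v, h, by omega, by omega⟩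

theorem Connected.dist_le_dist_add_one_of_adj (hG : G.Connected) (z : V) {u v : V}
    (h : G.Adj u v) : G.dist z v ≤ G.dist z u + 1 :=
  (hG.dist_triangle (v := u)).trans (by rw [dist_eq_one_iff_adj.2 h])

/-- If `m z` is at most the distance from `z` to every other vertex of `A`, then the balls of
radius `m z / 2` around the vertices of `A` are edge-disjoint, which bounds the sum of the `m z`. -/
theorem Subgraph.Connected.sum_le_two_mul_ncard_edgeSet [Finite V] (hG : G.Connected)
    {H : G.Subgraph} (hH : H.Connected) {A : Finset V} (hA : A.Nontrivial)
    (hAH : (A : Set V) ⊆ H.verts) (m : V → ℕ)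
    (hm : ∀ z ∈ A, ∀ w ∈ A, w ≠ z → m z ≤ G.dist z w) :
    ∑ z ∈ A, m z ≤ 2 * H.edgeSet.ncard := by
  classical
  have := Fintype.ofFinite V
  have hdart : ∀ z ∈ A, ∀ j < m z, ∃ d : V × V, H.Adj d.1 d.2 ∧
      (G.dist z d.1 = j / 2 ∧ G.dist z d.2 = j / 2 + 1 ∧ j % 2 = 0 ∨
        G.dist z d.2 = j / 2 ∧ G.dist z d.1 = j / 2 + 1 ∧ j % 2 = 1) := by
    intro z hz j hj
    obtain ⟨w, hw, hwz⟩ := hA.exists_ne z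
    obtain ⟨p⟩ := hH.coe.preconnected ⟨z, hAH hz⟩ ⟨w, hAH hw⟩
    obtain ⟨u, v, huv, hu, hv⟩ := p.exists_adj_eq_and_eq_add_one (fun x : H.verts => G.dist z x)
      (fun _ _ h => hG.dist_le_dist_add_one_of_adj z (H.adj_sub h)) (i := j / 2)
      (by simp) (by have := hm z hz w hw hwz; dsimp only; omega)
    rcases Nat.mod_two_eq_zero_or_one j with h | h
    · exact ⟨(u, v), huv, Or.inl ⟨hu, hv, h⟩⟩
    · exact ⟨(v, u), huv.symm, Or.inr ⟨hu, hv, h⟩⟩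
  choose! F hFadj hF using hdart
  have hcard : 2 * H.edgeSet.ncard = Fintype.card H.spanningCoe.Dart := by
    rw [dart_card_eq_twice_card_edges, ← Subgraph.edgeSet_spanningCoe,
      Set.ncard_eq_toFinset_card', edgeFinset]
  have hsum : ∑ z ∈ A, m z = (A.sigma fun z => Finset.range (m z)).card := by
    simp [Finset.card_sigma]
  have hdarts : Fintype.card H.spanningCoe.Dart =
      (Finset.univ.image fun d : H.spanningCoe.Dart => d.toProd).card := by
    rw [Finset.card_image_of_injective _ Dart.toProd_injective, Finset.card_univ]
  rw [hcard, hsum, hdarts]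
  refine Finset.card_le_card_of_injOn (fun q => F q.1 q.2) ?_ ?_
  · rintro ⟨z, j⟩ hq
    simp only [Finset.coe_sigma, Set.mem_sigma_iff, Finset.mem_coe, Finset.mem_range] at hq
    simp only [Finset.coe_image, Finset.coe_univ, Set.image_univ]
    exact ⟨⟨F z j, hFadj z hq.1 j hq.2⟩, rfl⟩
  · rintro ⟨z, j⟩ hq ⟨z', j'⟩ hq' h
    simp only [Finset.coe_sigma, Set.mem_sigma_iff, Finset.mem_coe, Finset.mem_range] at hq hq' h
    have h1 := hF z hq.1 j hq.2
    have h2 := hF z' hq'.1 j' hq'.2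
    rw [← h] at h2
    by_cases hzz : z' = z
    · subst hzz
      obtain rfl : j = j' := by omega
      rfl
    · have h3 := hm z hq.1 z' hq'.1 hzz
      have h4 := hm z' hq'.1 z hq.1 (Ne.symm hzz)
      have h5 := hG.dist_triangle (u := z) (v := (F z j).1) (w := z')
      have h6 := hG.dist_triangle (u := z) (v := (F z j).2) (w := z')
      rw [dist_comm] at h4
      rw [dist_comm (u := (F z j).1)] at h5
      rw [dist_comm (u := (F z j).2)] at h6
      omega

end SimpleGraph

section steinerDist

variable {V : Type*} {G : SimpleGraph V}

theorem steinerDist_le {H : G.Subgraph} (hH : H.Connected) {S : Set V} (hS : S ⊆ H.verts) :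
    steinerDist G S ≤ H.edgeSet.ncard :=
  Nat.sInf_le ⟨H, hH, hS, rfl⟩

theorem exists_ncard_edgeSet_eq_steinerDist (hG : G.Connected) (S : Set V) :
    ∃ H : G.Subgraph, H.Connected ∧ S ⊆ H.verts ∧ H.edgeSet.ncard = steinerDist G S :=
  Nat.sInf_mem (s := {n | ∃ H : G.Subgraph, H.Connected ∧ S ⊆ H.verts ∧ H.edgeSet.ncard = n})
    ⟨_, ⊤, ⟨SimpleGraph.Subgraph.topIso.connected_iff.2 hG⟩, by simp, rfl⟩

theorem steinerDist_insert_le [Finite V] (hG : G.Connected) {S : Set V} (z : V) {w : V}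
    (hw : w ∈ S) : steinerDist G (insert z S) ≤ steinerDist G S + G.dist z w := by
  classical
  obtain ⟨H, hH, hS, hcard⟩ := exists_ncard_edgeSet_eq_steinerDist hG S
  obtain ⟨p, hp⟩ := hG.exists_walk_length_eq_dist z w
  have hsup : (H ⊔ p.toSubgraph).Connected :=
    SimpleGraph.Subgraph.connected_sup hH.preconnected p.toSubgraph_connected.preconnected
      ⟨w, hS hw, p.end_mem_verts_toSubgraph⟩
  have hpcard : p.toSubgraph.edgeSet.ncard ≤ G.dist z w := by
    have : p.toSubgraph.edgeSet = (p.edges.toFinset : Set (Sym2 V)) := by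
      ext e; simp
    rw [this, Set.ncard_coe_finset, ← hp, ← p.length_edges]
    exact p.edges.toFinset_card_le
  refine (steinerDist_le hsup (Set.insert_subset ?_ ?_)).trans ?_
  · simp
  · exact hS.trans (by simp)
  · rw [SimpleGraph.Subgraph.edgeSet_sup, ← hcard]
    exact (Set.ncard_union_le _ _).trans (by omega)

theorem card_mul_steinerDist_le_sum_erase [Finite V] [DecidableEq V] (hG : G.Connected)
    {S : Finset V} {r : ℕ} (hr : 2 ≤ r) (hS : S.card = r + 1) :
    r * ((r + 1) * steinerDist G (S : Set V)) ≤
      (r + 2) * ∑ z ∈ S, steinerDist G (S.erase z : Set V) := by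
  have hS' : S.Nontrivial := Finset.one_lt_card_iff_nontrivial.1 (by omega)
  have hw : ∀ z ∈ S, ∃ w ∈ S.erase z, ∀ w' ∈ S.erase z, G.dist z w ≤ G.dist z w' := by
    intro z hz
    exact Finset.exists_min_image _ _ (hS'.erase_nonempty)
  choose! w hwS hw using hw
  have h1 : ∀ z ∈ S, steinerDist G (S : Set V) ≤
      steinerDist G (S.erase z : Set V) + G.dist z (w z) := by
    intro z hz
    have := steinerDist_insert_le hG z (Finset.mem_coe.2 (hwS z hz))
    rwa [← Finset.coe_insert, Finset.insert_erase hz] at this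
  have h2 : ∀ y ∈ S, ∑ z ∈ S.erase y, G.dist z (w z) ≤
      2 * steinerDist G (S.erase y : Set V) := by
    intro y hy
    obtain ⟨H, hH, hSH, hcard⟩ := exists_ncard_edgeSet_eq_steinerDist hG (S.erase y : Set V)
    rw [← hcard]
    refine hH.sum_le_two_mul_ncard_edgeSet hG
      (Finset.one_lt_card_iff_nontrivial.1 ?_) (by simpa using hSH) _ ?_
    · rw [Finset.card_erase_of_mem hy]; omega
    · intro z hz x hx hxz
      exact hw z (Finset.mem_of_mem_erase hz) x
        (Finset.mem_erase.2 ⟨hxz, Finset.mem_of_mem_erase hx⟩)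
  have h3 := Finset.sum_le_sum h1
  have h4 := Finset.sum_le_sum h2
  have h5 : ∑ y ∈ S, ∑ z ∈ S.erase y, G.dist z (w z) = r * ∑ z ∈ S, G.dist z (w z) := by
    have : ∀ y ∈ S, ∑ z ∈ S.erase y, G.dist z (w z) + G.dist y (w y) =
        ∑ z ∈ S, G.dist z (w z) := fun y hy => Finset.sum_erase_add _ _ hy
    have := Finset.sum_congr rfl this
    rw [Finset.sum_add_distrib, Finset.sum_const, hS, smul_eq_mul] at this
    linarith
  rw [Finset.sum_const, hS, smul_eq_mul, Finset.sum_add_distrib] at h3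
  rw [h5, ← Finset.mul_sum] at h4
  nlinarith [Nat.mul_le_mul_left r h3]

theorem mul_steinerWiener_succ_le [Fintype V] (hG : G.Connected) {r : ℕ} (hr : 2 ≤ r) :
    r * ((r + 1) * steinerWiener G (r + 1)) ≤
      (r + 2) * ((Fintype.card V - r) * steinerWiener G r) := by
  classical
  unfold steinerWiener
  rw [← Finset.sum_powersetCard_succ_sum_erase (fun S : Finset V => steinerDist G (S : Set V)) r,
    Finset.mul_sum, Finset.mul_sum, Finset.mul_sum]
  exact Finset.sum_le_sum fun S hS =>
    card_mul_steinerDist_le_sum_erase hG hr (Finset.mem_powersetCard.1 hS).2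

end steinerDist

/-- For a connected graph `G` on `n` vertices and `3 ≤ k ≤ n`,
`μ_k(G) ≤ ((k+1)/(k−1))·μ_{k−1}(G)`. -/
theorem avgSteinerDist_le_ratio {V : Type*} (G : SimpleGraph V) [Fintype V]
    (hG : G.Connected) (k : ℕ) (hk3 : 3 ≤ k) (hk : k ≤ Fintype.card V) :
    avgSteinerDist G k ≤ ((k : ℝ) + 1) / ((k : ℝ) - 1) * avgSteinerDist G (k - 1) := by
  obtain ⟨r, rfl⟩ : ∃ r, k = r + 1 := ⟨k - 1, by omega⟩
  have hr : 2 ≤ r := by omega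
  have hW := mul_steinerWiener_succ_le hG hr
  have hC := Nat.choose_succ_right_eq (Fintype.card V) r
  have hC0 : 0 < (Fintype.card V).choose r := Nat.choose_pos (by omega)
  have hC1 : 0 < (Fintype.card V).choose (r + 1) := Nat.choose_pos hk
  have hkey : r * steinerWiener G (r + 1) * (Fintype.card V).choose r ≤
      (r + 2) * steinerWiener G r * (Fintype.card V).choose (r + 1) := by
    refine Nat.le_of_mul_le_mul_left ?_ r.succ_pos
    calc (r + 1) * (r * steinerWiener G (r + 1) * (Fintype.card V).choose r)
        = r * ((r + 1) * steinerWiener G (r + 1)) * (Fintype.card V).choose r := by ring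
      _ ≤ (r + 2) * ((Fintype.card V - r) * steinerWiener G r) * (Fintype.card V).choose r :=
        Nat.mul_le_mul_right _ hW
      _ = (r + 2) * steinerWiener G r *
          ((Fintype.card V).choose r * (Fintype.card V - r)) := by ring
      _ = (r + 1) * ((r + 2) * steinerWiener G r * (Fintype.card V).choose (r + 1)) := by
        rw [← hC]; ring
  have hr0 : (0 : ℝ) < r := by exact_mod_cast (by omega : 0 < r)
  unfold avgSteinerDist
  rw [Nat.add_sub_cancel, Nat.cast_add_one, add_sub_cancel_right, add_assoc, one_add_one_eq_two,
    div_mul_div_comm, div_le_div_iff₀ (by exact_mod_cast hC1)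
      (mul_pos hr0 (by exact_mod_cast hC0))]
  have hkey' : (r : ℝ) * steinerWiener G (r + 1) * (Fintype.card V).choose r ≤
      (r + 2) * steinerWiener G r * (Fintype.card V).choose (r + 1) := by
    exact_mod_cast hkey
  linarith
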